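/- The pushforward of the normalized kinematic measure μ (on directed lines meeting the unit sphere S² ⊂ ℝ³) under the map (v, z) ↦ (X(v,z), Y(v,z)) sending a line to its ordered pair of intersection points with S² equals the product measure σ ⊗ σ, where σ is the uniform probability (normalized surface) measure on S². In other words, the entry point and the exit point of a random line are independent and each uniformly distributed on S². -/

import Mathlib

open MeasureTheory Metric Real Filter
open scoped ENNReal RealInnerProductSpace Topology

noncomputable section

/-- Euclidean space `ℝⁿ`. -/
abbrev En (n : ℕ) := EuclideanSpace ℝ (Fin n)

/-- The unit sphere `S^{n-1} ⊂ ℝⁿ`. -/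
def unitSphere (n : ℕ) : Set (En n) := Metric.sphere 0 1

/-- The uniform probability (normalized surface) measure on the unit sphere. -/
def sigmaN (n : ℕ) : Measure (En n) :=
  (μH[(n : ℝ) - 1] (unitSphere n))⁻¹ •
    (μH[(n : ℝ) - 1] : Measure (En n)).restrict (unitSphere n)

/-- The open unit disc in the hyperplane orthogonal to `v`. -/
def disc (n : ℕ) (v : En n) : Set (En n) := {z | ⟪v, z⟫ = 0 ∧ ‖z‖ < 1}

/-- Normalized `(n-1)`-dimensional Hausdorff measure on the disc `{z ∈ v⊥ : ‖z‖ < 1}`. -/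
def lambdaN (n : ℕ) (v : En n) : Measure (En n) :=
  (μH[(n : ℝ) - 1] (disc n v))⁻¹ •
    (μH[(n : ℝ) - 1] : Measure (En n)).restrict (disc n v)

/-- The normalized kinematic measure on directed lines meeting the unit sphere,
parametrized by pairs `(v, z)` with `v` the direction and `z ∈ v⊥`, `‖z‖ < 1`. -/
def kinematic (n : ℕ) : Measure (En n × En n) :=
  (sigmaN n).bind (fun v => (Measure.dirac v).prod (lambdaN n v))

/-- The entry point of the line parametrized by `(v, z)` in the unit sphere. -/
def Xpt (n : ℕ) (p : En n × En n) : En n := p.2 - Real.sqrt (1 - ‖p.2‖ ^ 2) • p.1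

/-- The exit point of the line parametrized by `(v, z)` in the unit sphere. -/
def Ypt (n : ℕ) (p : En n × En n) : En n := p.2 + Real.sqrt (1 - ‖p.2‖ ^ 2) • p.1


theorem avg_unique {G T R : Type*} [Group G] [MeasurableSpace G] [MeasurableMul G]
    [MeasurableSpace T] [MeasurableSpace R]
    (η : Measure G) [IsProbabilityMeasure η] [η.IsMulRightInvariant]
    (a : G → T → T) (ha : Measurable (fun q : G × T => a q.1 q.2))
    (hmul : ∀ g h p, a (g * h) p = a g (a h p))
    (P Q : Measure T) [IsProbabilityMeasure P] [IsProbabilityMeasure Q]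
    (hP : ∀ g, P.map (a g) = P) (hQ : ∀ g, Q.map (a g) = Q)
    (τ : T → R) (s : R → T) (hτ : Measurable τ) (hs : Measurable s)
    (oP : ∀ᵐ p ∂P, ∃ g, a g (s (τ p)) = p) (oQ : ∀ᵐ p ∂Q, ∃ g, a g (s (τ p)) = p)
    (h : P.map τ = Q.map τ) : P = Q := by
  have key : ∀ (M : Measure T) [IsProbabilityMeasure M] (_ : ∀ g, M.map (a g) = M)
      (_ : ∀ᵐ p ∂M, ∃ g, a g (s (τ p)) = p) (A : Set T) (_ : MeasurableSet A),
      M A = ∫⁻ t, (∫⁻ g, A.indicator 1 (a g (s t)) ∂η) ∂(M.map τ) := by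
    intro M _ hM oM A hA
    have hF : Measurable (A.indicator (1 : T → ℝ≥0∞)) := measurable_one.indicator hA
    have hm : ∀ g, Measurable (a g) := fun g => ha.comp measurable_prodMk_left
    have hF2 : Measurable (fun q : T × G => A.indicator (1 : T → ℝ≥0∞) (a q.2 q.1)) :=
      hF.comp (ha.comp measurable_swap)
    have hΦ : Measurable (fun p : T => ∫⁻ g, A.indicator (1 : T → ℝ≥0∞) (a g p) ∂η) :=
      hF2.lintegral_prod_right'
    have h1 : ∀ g, M A = ∫⁻ p, A.indicator (1 : T → ℝ≥0∞) (a g p) ∂M := by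
      intro g
      conv_lhs => rw [← hM g, ← lintegral_indicator_one hA]
      rw [lintegral_map hF (hm g)]
    calc M A = ∫⁻ g, M A ∂η := by simp
      _ = ∫⁻ g, ∫⁻ p, A.indicator (1 : T → ℝ≥0∞) (a g p) ∂M ∂η :=
          lintegral_congr fun g => h1 g
      _ = ∫⁻ p, ∫⁻ g, A.indicator (1 : T → ℝ≥0∞) (a g p) ∂η ∂M :=
          lintegral_lintegral_swap (hF.comp ha).aemeasurable
      _ = ∫⁻ p, (∫⁻ g, A.indicator 1 (a g (s (τ p))) ∂η) ∂M := by
          apply lintegral_congr_ae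
          filter_upwards [oM] with p hp
          obtain ⟨k, hk⟩ := hp
          conv_lhs => rw [← hk]
          simp_rw [← hmul]
          exact lintegral_mul_right_eq_self
            (fun g => A.indicator (1 : T → ℝ≥0∞) (a g (s (τ p)))) k
      _ = _ := by
          exact (lintegral_map (hΦ.comp hs) hτ).symm
  ext A hA
  rw [key P hP oP A hA, key Q hQ oQ A hA, h]

instance : ContinuousStar (En 3 →L[ℝ] En 3) :=
  ⟨(ContinuousLinearMap.adjoint (𝕜 := ℝ) (E := En 3) (F := En 3)).continuous⟩

/-- The orthogonal group. -/
abbrev OG : Type := ↥(unitary (En 3 →L[ℝ] En 3))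

instance : MeasurableSpace OG := borel _
instance : BorelSpace OG := ⟨rfl⟩

instance : CompactSpace OG := by
  refine isCompact_iff_compactSpace.1 (?_ : IsCompact
    ((unitary (En 3 →L[ℝ] En 3) : Submonoid _) : Set (En 3 →L[ℝ] En 3)))
  apply Metric.isCompact_of_isClosed_isBounded
  · have : ((unitary (En 3 →L[ℝ] En 3) : Submonoid _) : Set (En 3 →L[ℝ] En 3)) =
      {x | star x * x = 1} ∩ {x | x * star x = 1} := by
      ext x; simp [Unitary.mem_iff]
    rw [this]
    exact (isClosed_eq (by fun_prop) (by fun_prop)).inter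
      (isClosed_eq (by fun_prop) (by fun_prop))
  · rw [isBounded_iff_forall_norm_le]
    refine ⟨1, fun x hx => ?_⟩
    exact CStarRing.norm_of_mem_unitary hx |>.le

/-- right-invariant probability Haar measure on the orthogonal group -/
theorem exists_haar : ∃ η : Measure OG, IsProbabilityMeasure η ∧ η.IsMulRightInvariant := by
  let K : TopologicalSpace.PositiveCompacts OG := ⊤
  refine ⟨(Measure.haarMeasure K).inv, ?_, inferInstance⟩
  constructor
  rw [Measure.inv_apply]
  simpa [K] using Measure.haarMeasure_self (K₀ := K)

theorem og_mul (g h : OG) (x : En 3) :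
    ((g * h : OG) : En 3 →L[ℝ] En 3) x = (g : En 3 →L[ℝ] En 3) ((h : En 3 →L[ℝ] En 3) x) := rfl

theorem og_of_isom (f : En 3 ≃ₗᵢ[ℝ] En 3) : ∃ g : OG, ∀ x, (g : En 3 →L[ℝ] En 3) x = f x := by
  refine ⟨Unitary.linearIsometryEquiv.symm f, fun x => rfl⟩

theorem isom_of_og (g : OG) : ∃ f : En 3 ≃ₗᵢ[ℝ] En 3, ∀ x, (g : En 3 →L[ℝ] En 3) x = f x := by
  refine ⟨Unitary.linearIsometryEquiv g, fun x => rfl⟩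

/-- Uniqueness for invariant measures on pairs. -/
theorem unique_pair (P Q : Measure (En 3 × En 3)) [IsProbabilityMeasure P] [IsProbabilityMeasure Q]
    (hP : ∀ f : En 3 ≃ₗᵢ[ℝ] En 3, P.map (Prod.map f f) = P)
    (hQ : ∀ f : En 3 ≃ₗᵢ[ℝ] En 3, Q.map (Prod.map f f) = Q)
    (sP : ∀ᵐ p ∂P, ‖p.1‖ = 1 ∧ ‖p.2‖ = 1) (sQ : ∀ᵐ p ∂Q, ‖p.1‖ = 1 ∧ ‖p.2‖ = 1)
    (h : P.map (fun p => ⟪p.1, p.2⟫) = Q.map (fun p => ⟪p.1, p.2⟫)) : P = Q := by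
  obtain ⟨η, _, _⟩ := exists_haar
  let s : ℝ → En 3 × En 3 := fun t => (EuclideanSpace.single 0 1,
    t • EuclideanSpace.single 0 1 + √(1 - t^2) • EuclideanSpace.single 1 1)
  have orb : ∀ p : En 3 × En 3, (‖p.1‖ = 1 ∧ ‖p.2‖ = 1) → ∃ g : OG,
      (fun (g : OG) (p : En 3 × En 3) =>
        ((g : En 3 →L[ℝ] En 3) p.1, (g : En 3 →L[ℝ] En 3) p.2)) g (s ⟪p.1, p.2⟫) = p := by
    rintro ⟨x, y⟩ ⟨hx, hy⟩
    simp only at hx hy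
    set t : ℝ := ⟪x, y⟫ with ht
    have ht1 : 0 ≤ 1 - t^2 := by
      have := abs_real_inner_le_norm x y
      rw [hx, hy, ← ht] at this
      have := (sq_le_one_iff_abs_le_one t).2 (by linarith)
      linarith
    have i1 : ‖(s t).1‖ = 1 := by simp [s]
    have i2 : ⟪(s t).1, (s t).2⟫ = t := by
      simp [s, inner_add_right, inner_smul_right, EuclideanSpace.inner_single_left]
    have i3 : ‖(s t).2‖ = 1 := by
      have : ‖(s t).2‖^2 = 1 := by
        simp only [EuclideanSpace.norm_sq_eq, Fin.sum_univ_three, s]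
        simp [Real.sq_sqrt ht1]
      nlinarith [norm_nonneg (s t).2]
    let f1 := (ℝ ∙ ((s t).1 - x))ᗮ.reflection
    have h1 : f1 (s t).1 = x := Submodule.reflection_sub (by rw [i1, hx])
    let y' := f1 (s t).2
    have hy' : ‖y'‖ = 1 := by simp [y', i3]
    have hxy' : ⟪x, y'⟫ = t := by rw [← h1, LinearIsometryEquiv.inner_map_map, i2]
    let f2 := (ℝ ∙ (y' - y))ᗮ.reflection
    have h2 : f2 y' = y := Submodule.reflection_sub (by rw [hy', hy])
    have h3 : f2 x = x := by
      apply Submodule.reflection_mem_subspace_eq_self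
      rw [Submodule.mem_orthogonal_singleton_iff_inner_left, inner_sub_right, hxy', ← ht, sub_self]
    obtain ⟨g, hg⟩ := og_of_isom (f1.trans f2)
    refine ⟨g, ?_⟩
    simp only [hg, LinearIsometryEquiv.trans_apply, h1, h3]
    exact Prod.ext rfl h2
  refine avg_unique η (fun (g : OG) (p : En 3 × En 3) =>
    ((g : En 3 →L[ℝ] En 3) p.1, (g : En 3 →L[ℝ] En 3) p.2)) ?_ ?_ P Q ?_ ?_
    (fun p => ⟪p.1, p.2⟫) s ?_ ?_ (sP.mono fun p hp => orb p hp) (sQ.mono fun p hp => orb p hp) h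
  · apply Continuous.measurable
    fun_prop
  · intros; rfl
  · intro g
    obtain ⟨f, hf⟩ := isom_of_og g
    simp only [hf]; exact hP f
  · intro g
    obtain ⟨f, hf⟩ := isom_of_og g
    simp only [hf]; exact hQ f
  · apply Continuous.measurable; fun_prop
  · apply Continuous.measurable; fun_prop

/-- Uniqueness for invariant measures on the sphere. -/
theorem unique_single (P Q : Measure (En 3)) [IsProbabilityMeasure P] [IsProbabilityMeasure Q]
    (hP : ∀ f : En 3 ≃ₗᵢ[ℝ] En 3, P.map f = P)
    (hQ : ∀ f : En 3 ≃ₗᵢ[ℝ] En 3, Q.map f = Q)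
    (sP : ∀ᵐ p ∂P, ‖p‖ = 1) (sQ : ∀ᵐ p ∂Q, ‖p‖ = 1) : P = Q := by
  obtain ⟨η, _, _⟩ := exists_haar
  have orb : ∀ p : En 3, (‖p‖ = 1) → ∃ g : OG,
      (fun (g : OG) (p : En 3) => (g : En 3 →L[ℝ] En 3) p) g (EuclideanSpace.single 0 1) = p := by
    intro x hx
    obtain ⟨g, hg⟩ := og_of_isom (ℝ ∙ (EuclideanSpace.single 0 1 - x))ᗮ.reflection
    refine ⟨g, ?_⟩
    simp only [hg]
    exact Submodule.reflection_sub (by simp [hx])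
  refine avg_unique η (fun (g : OG) (p : En 3) => (g : En 3 →L[ℝ] En 3) p) ?_ ?_ P Q ?_ ?_
    (fun p => ()) (fun _ => EuclideanSpace.single 0 1) ?_ ?_
    (sP.mono fun p hp => orb p hp) (sQ.mono fun p hp => orb p hp) ?_
  · apply Continuous.measurable
    fun_prop
  · intros; rfl
  · intro g
    obtain ⟨f, hf⟩ := isom_of_og g
    simp only [hf]; exact hP f
  · intro g
    obtain ⟨f, hf⟩ := isom_of_og g
    simp only [hf]; exact hQ f
  · fun_prop
  · fun_prop
  · simp

/-- base vector -/
def e0 : En 3 := EuclideanSpace.single 0 1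

theorem norm_e0 : ‖e0‖ = 1 := by simp [e0]

theorem inner_e0 (z : En 3) : ⟪e0, z⟫ = z 0 := by
  simp [e0, EuclideanSpace.inner_single_left]

theorem two_eq : ((3 : ℕ) : ℝ) - 1 = ((Module.finrank ℝ (En 2) : ℕ) : ℝ) := by
  simp; norm_num

instance haar2 : Measure.IsAddHaarMeasure (μH[((3 : ℕ) : ℝ) - 1] : Measure (En 2)) := by
  rw [two_eq]; infer_instance

theorem two_nonneg : (0 : ℝ) ≤ ((3 : ℕ) : ℝ) - 1 := by norm_num

/-- inclusion of the plane -/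
def incl (y : En 2) : En 3 := !₂[0, y 0, y 1]

theorem incl_isometry : Isometry incl := by
  apply Isometry.of_dist_eq
  intro x y
  simp [EuclideanSpace.dist_eq, incl, Fin.sum_univ_three, Fin.sum_univ_two]

theorem incl_norm (y : En 2) : ‖incl y‖ = ‖y‖ := by
  simp [EuclideanSpace.norm_eq, incl, Fin.sum_univ_three, Fin.sum_univ_two]

theorem disc_eq : disc 3 e0 = incl '' ball 0 1 := by
  ext z
  simp only [disc, Set.mem_ofPred_eq, inner_e0, Set.mem_image, mem_ball_zero_iff]
  constructor
  · rintro ⟨h0, h1⟩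
    have : incl !₂[z 1, z 2] = z := by
      ext i; fin_cases i <;> simp [incl, h0]
    refine ⟨!₂[z 1, z 2], ?_, this⟩
    rwa [← incl_norm, this]
  · rintro ⟨y, hy, rfl⟩
    rw [incl_norm]
    exact ⟨by simp [incl], hy⟩

theorem H_disc_pos : μH[((3 : ℕ) : ℝ) - 1] (disc 3 e0) ≠ 0 := by
  rw [disc_eq, incl_isometry.hausdorffMeasure_image (Or.inl two_nonneg)]
  exact (isOpen_ball.measure_pos _ ⟨0, by simp⟩).ne'

theorem H_disc_fin : μH[((3 : ℕ) : ℝ) - 1] (disc 3 e0) ≠ ⊤ := by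
  rw [disc_eq, incl_isometry.hausdorffMeasure_image (Or.inl two_nonneg)]
  exact measure_ball_lt_top.ne

/-- projection on the plane -/
def proj (x : En 3) : En 2 := !₂[x 1, x 2]

theorem proj_lip : LipschitzWith 1 proj := by
  apply LipschitzWith.of_dist_le_mul
  intro x y
  simp only [EuclideanSpace.dist_eq, proj, Fin.sum_univ_three, Fin.sum_univ_two, NNReal.coe_one,
    one_mul]
  apply Real.sqrt_le_sqrt
  simp

theorem H_sphere_pos : μH[((3 : ℕ) : ℝ) - 1] (unitSphere 3) ≠ 0 := by
  intro h
  have h1 := proj_lip.hausdorffMeasure_image_le two_nonneg (unitSphere 3)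
  rw [h, mul_zero, nonpos_iff_eq_zero] at h1
  have h2 : ball 0 1 ⊆ proj '' (unitSphere 3) := by
    intro y hy
    rw [mem_ball_zero_iff] at hy
    have hs : y 0 ^ 2 + y 1 ^ 2 = ‖y‖ ^ 2 := by
      simp [EuclideanSpace.norm_sq_eq, Fin.sum_univ_two]
    have hs' : 0 ≤ 1 - (y 0 ^ 2 + y 1 ^ 2) := by
      rw [hs]; nlinarith [norm_nonneg y]
    refine ⟨!₂[√(1 - (y 0 ^ 2 + y 1 ^ 2)), y 0, y 1], ?_, ?_⟩
    · simp [unitSphere, EuclideanSpace.norm_eq, Fin.sum_univ_three, Real.sq_sqrt hs', add_assoc]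
    · ext i; fin_cases i <;> simp [proj]
  have h3 := measure_mono_null h2 h1
  exact (isOpen_ball.measure_pos (μH[((3 : ℕ) : ℝ) - 1] : Measure (En 2)) ⟨0, by simp⟩).ne' h3

/-- spherical parametrization -/
def sph (y : En 2) : En 3 := !₂[cos (y 0) * cos (y 1), cos (y 0) * sin (y 1), sin (y 0)]

theorem sph_contDiff : ContDiff ℝ 1 sph := by
  rw [contDiff_euclidean]
  intro i
  fin_cases i <;> simp [sph] <;> fun_prop

theorem H_sphere_fin : μH[((3 : ℕ) : ℝ) - 1] (unitSphere 3) ≠ ⊤ := by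
  have hsub : unitSphere 3 ⊆ sph '' closedBall 0 10 := by
    intro x hx
    have hx : x 0 ^ 2 + x 1 ^ 2 + x 2 ^ 2 = 1 := by
      have : ‖x‖ ^ 2 = 1 := by
        simp [unitSphere] at hx
        simp [hx]
      simpa [EuclideanSpace.norm_sq_eq, Fin.sum_univ_three] using this
    have ha : sin (arcsin (x 2)) = x 2 := Real.sin_arcsin (by nlinarith) (by nlinarith)
    let w : ℂ := ⟨x 0, x 1⟩
    have hw : ‖w‖ = cos (arcsin (x 2)) := by
      rw [Real.cos_arcsin, Complex.norm_eq_sqrt_sq_add_sq]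
      congr 1
      simp only [w]; linarith
    have h0 : cos (arcsin (x 2)) * cos (w.arg) = x 0 := by
      rw [← hw, Complex.norm_mul_cos_arg]
    have h1 : cos (arcsin (x 2)) * sin (w.arg) = x 1 := by
      rw [← hw, Complex.norm_mul_sin_arg]
    refine ⟨!₂[arcsin (x 2), w.arg], ?_, ?_⟩
    · rw [mem_closedBall_zero_iff, EuclideanSpace.norm_eq, Real.sqrt_le_left (by norm_num)]
      simp only [Fin.sum_univ_two, Real.norm_eq_abs, sq_abs]
      simp
      have := Real.arcsin_le_pi_div_two (x 2)
      have := Real.neg_pi_div_two_le_arcsin (x 2)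
      have := Complex.arg_le_pi w
      have := Complex.neg_pi_lt_arg w
      have := Real.pi_lt_four
      nlinarith
    · ext i; fin_cases i <;> simp [sph, h0, h1, ha]
  have hc : IsCompact (closedBall (0 : En 2) 10) := isCompact_closedBall 0 10
  have hfin : μH[((3 : ℕ) : ℝ) - 1] (sph '' closedBall 0 10) < ⊤ := by
    obtain ⟨K, hK⟩ := (sph_contDiff.locallyLipschitz.locallyLipschitzOn
      (s := closedBall 0 10)).exists_lipschitzOnWith_of_compact hc
    refine (hK.hausdorffMeasure_image_le two_nonneg).trans_lt ?_
    exact ENNReal.mul_lt_top (ENNReal.rpow_lt_top_of_nonneg two_nonneg (by simp))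
      hc.measure_lt_top
  exact ((measure_mono hsub).trans_lt hfin).ne

theorem meas_sphere : MeasurableSet (unitSphere 3) := isClosed_sphere.measurableSet

theorem meas_disc (v : En 3) : MeasurableSet (disc 3 v) := by
  have h1 : MeasurableSet {z : En 3 | ⟪v, z⟫ = 0} :=
    (isClosed_eq (by fun_prop) (by fun_prop)).measurableSet
  have h2 : MeasurableSet {z : En 3 | ‖z‖ < 1} :=
    (isOpen_lt (by fun_prop) (by fun_prop)).measurableSet
  exact h1.inter h2

instance sigma_prob : IsProbabilityMeasure (sigmaN 3) := by
  constructor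
  simp only [sigmaN, Measure.smul_apply, Measure.restrict_apply_univ, smul_eq_mul]
  exact ENNReal.inv_mul_cancel H_sphere_pos H_sphere_fin

instance lambda_prob : IsProbabilityMeasure (lambdaN 3 e0) := by
  constructor
  simp only [lambdaN, Measure.smul_apply, Measure.restrict_apply_univ, smul_eq_mul]
  exact ENNReal.inv_mul_cancel H_disc_pos H_disc_fin

theorem sigma_ae : ∀ᵐ x ∂(sigmaN 3), ‖x‖ = 1 := by
  apply Measure.ae_smul_measure
  filter_upwards [ae_restrict_mem meas_sphere] with x hx
  simpa [unitSphere] using hx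

theorem lambda_ae (v : En 3) : ∀ᵐ z ∂(lambdaN 3 v), ⟪v, z⟫ = 0 ∧ ‖z‖ < 1 := by
  apply Measure.ae_smul_measure
  filter_upwards [ae_restrict_mem (meas_disc v)] with x hx
  exact hx

theorem sigma_map (f : En 3 ≃ₗᵢ[ℝ] En 3) : (sigmaN 3).map f = sigmaN 3 := by
  have h1 : (unitSphere 3) = f ⁻¹' (unitSphere 3) := by
    ext x; simp [unitSphere]
  have := (f.toIsometryEquiv.measurePreserving_hausdorffMeasure (((3 : ℕ) : ℝ) - 1)).restrict_preimage
    meas_sphere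
  rw [sigmaN, Measure.map_smul]
  congr 1
  conv_lhs => rw [h1]
  exact this.map_eq

theorem lambda_map (f : En 3 ≃ₗᵢ[ℝ] En 3) (v : En 3) :
    (lambdaN 3 v).map f = lambdaN 3 (f v) := by
  have h1 : disc 3 v = f ⁻¹' (disc 3 (f v)) := by
    ext x; simp [disc]
  have h := (f.toIsometryEquiv.measurePreserving_hausdorffMeasure (((3 : ℕ) : ℝ) - 1))
  have := h.restrict_preimage (meas_disc (f v))
  have h2 := h.measure_preimage (meas_disc (f v)).nullMeasurableSet
  change _ = _ at h2
  rw [lambdaN, Measure.map_smul, lambdaN, ← h2]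
  congr 1
  · rw [h1]; rfl
  · conv_lhs => rw [h1]
    exact this.map_eq

open scoped Pointwise in
theorem lambda_ball (r : ℝ) (h0 : 0 ≤ r) (h1 : r ≤ 1) :
    lambdaN 3 e0 {z | ‖z‖ < r} = ENNReal.ofReal (r ^ 2) := by
  rcases h0.eq_or_lt with rfl | h0
  · have : {z : En 3 | ‖z‖ < 0} = ∅ := by ext z; simp
    simp [this]
  have hm : MeasurableSet {z : En 3 | ‖z‖ < r} :=
    (isOpen_lt (by fun_prop) (by fun_prop)).measurableSet
  have : {z : En 3 | ‖z‖ < r} ∩ disc 3 e0 = r • disc 3 e0 := by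
    ext z
    rw [Set.mem_smul_set_iff_inv_smul_mem₀ h0.ne']
    simp only [disc, Set.mem_inter_iff, Set.mem_ofPred_eq, inner_smul_right, norm_smul, norm_inv,
      Real.norm_eq_abs, abs_of_pos h0, mul_eq_zero, inv_eq_zero, h0.ne', false_or]
    rw [inv_mul_lt_one₀ h0]
    constructor
    · rintro ⟨a, b, c⟩; exact ⟨b, a⟩
    · rintro ⟨b, a⟩; exact ⟨a, b, a.trans_le h1⟩
  rw [lambdaN, Measure.smul_apply, Measure.restrict_apply hm, this,
    Measure.hausdorffMeasure_smul₀ two_nonneg h0.ne', smul_eq_mul, ENNReal.smul_def, smul_eq_mul,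
    mul_left_comm, ENNReal.inv_mul_cancel H_disc_pos H_disc_fin, mul_one]
  have : ((3 : ℕ) : ℝ) - 1 = ((2 : ℕ) : ℝ) := by norm_num
  rw [this, NNReal.rpow_natCast, ENNReal.ofReal_pow h0.le, ENNReal.coe_pow]
  congr 1
  rw [← enorm_eq_nnnorm, Real.enorm_of_nonneg h0.le]

/-- explicit reflection exchanging `e0` and `v` -/
def refl3 (v z : En 3) : En 3 := z - (2 * (⟪v - e0, z⟫ / ‖v - e0‖ ^ 2)) • (v - e0)

theorem refl3_meas : Measurable (fun p : En 3 × En 3 => refl3 p.1 p.2) := by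
  unfold refl3
  fun_prop

theorem refl3_eq (v : En 3) (hv : ‖v‖ = 1) :
    ∃ f : En 3 ≃ₗᵢ[ℝ] En 3, (∀ z, f z = refl3 v z) ∧ f e0 = v := by
  refine ⟨(ℝ ∙ (v - e0))ᗮ.reflection, ?_, ?_⟩
  · intro z
    rw [Submodule.reflection_orthogonal_apply, Submodule.reflection_singleton_apply, refl3, mul_smul,
      two_smul, two_smul]
    simp
  · have h := Submodule.reflection_sub (v := v) (w := e0) (by rw [hv, norm_e0])
    have hrr := Submodule.reflection_reflection (ℝ ∙ (v - e0))ᗮ v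
    rwa [h] at hrr

/-- measurable version of the kernel -/
def kap (v : En 3) : Measure (En 3 × En 3) := (lambdaN 3 e0).map (fun z => (v, refl3 v z))

theorem refl3_meas' (v : En 3) : Measurable (refl3 v) := refl3_meas.comp measurable_prodMk_left

theorem kap_meas : Measurable kap := by
  apply Measure.measurable_of_measurable_coe
  intro A hA
  have h1 : ∀ v, kap v A = lambdaN 3 e0 (Prod.mk v ⁻¹'
      ((fun p : En 3 × En 3 => (p.1, refl3 p.1 p.2)) ⁻¹' A)) := by
    intro v
    rw [kap, Measure.map_apply (measurable_const.prodMk (refl3_meas' v)) hA]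
    rfl
  simp_rw [h1]
  exact measurable_measure_prodMk_left ((measurable_fst.prodMk refl3_meas) hA)

theorem lambda_unit (v : En 3) (hv : ‖v‖ = 1) :
    ∃ f : En 3 ≃ₗᵢ[ℝ] En 3, (∀ z, f z = refl3 v z) ∧ (lambdaN 3 e0).map f = lambdaN 3 v := by
  obtain ⟨f, h1, h2⟩ := refl3_eq v hv
  exact ⟨f, h1, by rw [lambda_map, h2]⟩

theorem lambda_prob' (v : En 3) (hv : ‖v‖ = 1) : IsProbabilityMeasure (lambdaN 3 v) := by
  obtain ⟨f, h1, h2⟩ := lambda_unit v hv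
  rw [← h2]
  exact Measure.isProbabilityMeasure_map f.continuous.measurable.aemeasurable

theorem kap_eq (v : En 3) (hv : ‖v‖ = 1) : (Measure.dirac v).prod (lambdaN 3 v) = kap v := by
  have := lambda_prob' v hv
  obtain ⟨f, h1, h2⟩ := lambda_unit v hv
  rw [Measure.dirac_prod, ← h2, Measure.map_map measurable_prodMk_left f.continuous.measurable, kap]
  congr 1
  ext z : 1
  simp [h1]

theorem ker_aemeas : AEMeasurable (fun v => (Measure.dirac v).prod (lambdaN 3 v)) (sigmaN 3) := by
  refine ⟨kap, kap_meas, ?_⟩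
  filter_upwards [sigma_ae] with v hv using kap_eq v hv

/-- the chord map -/
def XY (p : En 3 × En 3) : En 3 × En 3 := (Xpt 3 p, Ypt 3 p)

theorem XY_meas : Measurable XY := by
  apply Continuous.measurable
  unfold XY Xpt Ypt
  fun_prop

/-- the pushforward -/
def PP : Measure (En 3 × En 3) := (kinematic 3).map XY

theorem PP_apply (A : Set (En 3 × En 3)) (hA : MeasurableSet A) :
    PP A = ∫⁻ v, lambdaN 3 v {z | XY (v, z) ∈ A} ∂(sigmaN 3) := by
  rw [PP, Measure.map_apply XY_meas hA, kinematic, Measure.bind_apply (XY_meas hA) ker_aemeas]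
  apply lintegral_congr_ae
  filter_upwards [sigma_ae] with v hv
  have := lambda_prob' v hv
  rw [Measure.dirac_prod, Measure.map_apply measurable_prodMk_left (XY_meas hA)]
  rfl

instance PP_prob : IsProbabilityMeasure PP := by
  constructor
  rw [PP_apply _ MeasurableSet.univ]
  have : ∫⁻ v, lambdaN 3 v {z | XY (v, z) ∈ Set.univ} ∂(sigmaN 3) = ∫⁻ v, 1 ∂(sigmaN 3) := by
    apply lintegral_congr_ae
    filter_upwards [sigma_ae] with v hv
    have := lambda_prob' v hv
    simp
  rw [this]; simp

theorem XY_map (f : En 3 ≃ₗᵢ[ℝ] En 3) (v z : En 3) : XY (f v, f z) = Prod.map f f (XY (v, z)) := by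
  simp [XY, Xpt, Ypt]

theorem PP_map (f : En 3 ≃ₗᵢ[ℝ] En 3) : PP.map (Prod.map f f) = PP := by
  have hf : Measurable f := f.continuous.measurable
  ext A hA
  rw [Measure.map_apply (hf.prodMap hf) hA, PP_apply _ ((hf.prodMap hf) hA), PP_apply _ hA]
  have h1 : ∀ v, lambdaN 3 v {z | XY (v, z) ∈ Prod.map f f ⁻¹' A} =
      lambdaN 3 (f v) {z | XY (f v, z) ∈ A} := by
    intro v
    have hm : MeasurableSet {z | XY (f v, z) ∈ A} := (XY_meas.comp measurable_prodMk_left) hA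
    rw [← lambda_map, Measure.map_apply hf hm]
    congr 1
    ext z
    simp [XY_map]
  simp_rw [h1]
  have hp : MeasurePreserving f (sigmaN 3) (sigmaN 3) := ⟨hf, sigma_map f⟩
  exact hp.lintegral_comp_emb f.toHomeomorph.measurableEmbedding
    (fun v => lambdaN 3 v {z | XY (v, z) ∈ A})

theorem XY_norm (v z : En 3) (hv : ‖v‖ = 1) (hz : ⟪v, z⟫ = 0 ∧ ‖z‖ < 1) :
    ‖(XY (v, z)).1‖ = 1 ∧ ‖(XY (v, z)).2‖ = 1 ∧ ⟪(XY (v, z)).1, (XY (v, z)).2⟫ = 2 * ‖z‖ ^ 2 - 1 := by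
  obtain ⟨h0, h1⟩ := hz
  have h2 : 0 ≤ 1 - ‖z‖ ^ 2 := by nlinarith [norm_nonneg z]
  have hs := Real.mul_self_sqrt h2
  have h0' : ⟪z, v⟫ = 0 := by rw [real_inner_comm]; exact h0
  have vv : ⟪v, v⟫ = 1 := by rw [real_inner_self_eq_norm_sq, hv]; norm_num
  have zz := real_inner_self_eq_norm_sq z
  refine ⟨?_, ?_, ?_⟩
  · rw [← sq_eq_sq₀ (norm_nonneg _) zero_le_one, ← real_inner_self_eq_norm_sq]
    simp only [XY, Xpt, inner_sub_left, inner_sub_right, inner_smul_left, inner_smul_right, h0, h0',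
      vv, zz]
    simp; linarith
  · rw [← sq_eq_sq₀ (norm_nonneg _) zero_le_one, ← real_inner_self_eq_norm_sq]
    simp only [XY, Ypt, inner_add_left, inner_add_right, inner_smul_left, inner_smul_right, h0, h0',
      vv, zz]
    simp; linarith
  · simp only [XY, Xpt, Ypt, inner_add_right, inner_sub_left, inner_smul_left, inner_smul_right,
      h0, h0', vv, zz]
    simp; linarith

theorem PP_ae : ∀ᵐ p ∂PP, ‖p.1‖ = 1 ∧ ‖p.2‖ = 1 := by
  have hA : MeasurableSet {p : En 3 × En 3 | ‖p.1‖ = 1 ∧ ‖p.2‖ = 1} := by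
    have h1 : MeasurableSet {p : En 3 × En 3 | ‖p.1‖ = 1} :=
      (isClosed_eq (by fun_prop) (by fun_prop)).measurableSet
    have h2 : MeasurableSet {p : En 3 × En 3 | ‖p.2‖ = 1} :=
      (isClosed_eq (by fun_prop) (by fun_prop)).measurableSet
    exact h1.inter h2
  rw [ae_iff]
  change PP {p : En 3 × En 3 | ‖p.1‖ = 1 ∧ ‖p.2‖ = 1}ᶜ = 0
  rw [PP_apply _ hA.compl]
  rw [← lintegral_zero (μ := sigmaN 3)]
  apply lintegral_congr_ae
  filter_upwards [sigma_ae] with v hv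
  have : ∀ᵐ z ∂(lambdaN 3 v), ‖(XY (v, z)).1‖ = 1 ∧ ‖(XY (v, z)).2‖ = 1 := by
    filter_upwards [lambda_ae v] with z hz
    have := XY_norm v z hv hz
    exact ⟨this.1, this.2.1⟩
  exact ae_iff.1 this

theorem PP_law (s : ℝ) (h1 : -1 ≤ s) (h2 : s ≤ 1) :
    PP.map (fun p => ⟪p.1, p.2⟫) (Set.Iio s) = ENNReal.ofReal ((1 + s) / 2) := by
  have hm : Measurable (fun p : En 3 × En 3 => ⟪p.1, p.2⟫) := by
    apply Continuous.measurable; fun_prop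
  rw [Measure.map_apply hm measurableSet_Iio, PP_apply _ (hm measurableSet_Iio)]
  have : ∫⁻ v, lambdaN 3 v {z | XY (v, z) ∈ (fun p : En 3 × En 3 => ⟪p.1, p.2⟫) ⁻¹' Set.Iio s}
      ∂(sigmaN 3) = ∫⁻ v, ENNReal.ofReal ((1 + s) / 2) ∂(sigmaN 3) := by
    apply lintegral_congr_ae
    filter_upwards [sigma_ae] with v hv
    have e : lambdaN 3 v {z | XY (v, z) ∈ (fun p : En 3 × En 3 => ⟪p.1, p.2⟫) ⁻¹' Set.Iio s} =
      lambdaN 3 v {z | ‖z‖ < √((1 + s) / 2)} := by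
      apply measure_congr
      filter_upwards [lambda_ae v] with z hz
      obtain ⟨-, -, h⟩ := XY_norm v z hv hz
      apply propext
      change ⟪(XY (v, z)).1, (XY (v, z)).2⟫ < s ↔ ‖z‖ < √((1 + s) / 2)
      rw [h, Real.lt_sqrt (norm_nonneg _)]
      constructor <;> intro <;> linarith
    rw [e]
    obtain ⟨f, -, h⟩ := lambda_unit v hv
    have hmz : MeasurableSet {z : En 3 | ‖z‖ < √((1 + s) / 2)} :=
      (isOpen_lt (by fun_prop) (by fun_prop)).measurableSet
    rw [← h, Measure.map_apply f.continuous.measurable hmz]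
    have := lambda_ball √((1 + s) / 2) (Real.sqrt_nonneg _)
      (Real.sqrt_le_one.2 (by linarith))
    rw [Real.sq_sqrt (by linarith)] at this
    rw [← this]
    congr 1
    ext z; simp
  rw [this]; simp

/-- splitting off the first coordinate -/
def split3 (x : En 3) : ℝ × En 2 := (x 0, !₂[x 1, x 2])

theorem split3_mp : MeasurePreserving split3 volume volume := by
  have h1 := PiLp.volume_preserving_ofLp (Fin 3)
  have h2 := volume_preserving_piFinSuccAbove (fun _ : Fin 3 => ℝ) 0
  have h3 := PiLp.volume_preserving_toLp (Fin 2)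
  have h4 := (MeasurePreserving.id (volume : Measure ℝ)).prod h3
  have h5 := h4.comp (h2.comp h1)
  have he : split3 = Prod.map id (WithLp.toLp 2) ∘
      (MeasurableEquiv.piFinSuccAbove (fun _ : Fin 3 => ℝ) 0) ∘ WithLp.ofLp := by
    funext x
    refine Prod.ext rfl ?_
    ext i
    fin_cases i <;> rfl
  rw [he]
  exact h5

theorem split3_norm (x : En 3) : ‖x‖ = √((split3 x).1 ^ 2 + ‖(split3 x).2‖ ^ 2) := by
  rw [EuclideanSpace.norm_sq_eq, EuclideanSpace.norm_eq]
  simp [split3, Fin.sum_univ_three, Fin.sum_univ_two, add_assoc]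

/-- the solid cone -/
def coneT (t : ℝ) : Set (ℝ × En 2) :=
  {p | √(p.1 ^ 2 + ‖p.2‖ ^ 2) < 1 ∧ t * √(p.1 ^ 2 + ‖p.2‖ ^ 2) ≤ p.1}

theorem coneT_meas (t : ℝ) : MeasurableSet (coneT t) := by
  have h1 : MeasurableSet {p : ℝ × En 2 | √(p.1 ^ 2 + ‖p.2‖ ^ 2) < 1} :=
    (isOpen_lt (by fun_prop) (by fun_prop)).measurableSet
  have h2 : MeasurableSet {p : ℝ × En 2 | t * √(p.1 ^ 2 + ‖p.2‖ ^ 2) ≤ p.1} :=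
    (isClosed_le (by fun_prop) (by fun_prop)).measurableSet
  exact h1.inter h2

theorem cone_cond (t : ℝ) (h0 : 0 ≤ t) (a : ℝ) (ha : 0 < a) (y : En 2) :
    (a, y) ∈ coneT t ↔ ‖y‖ ^ 2 < 1 - a ^ 2 ∧ t ^ 2 * ‖y‖ ^ 2 ≤ a ^ 2 * (1 - t ^ 2) := by
  have hn : 0 ≤ a ^ 2 + ‖y‖ ^ 2 := by positivity
  have e1 : √(a ^ 2 + ‖y‖ ^ 2) < 1 ↔ ‖y‖ ^ 2 < 1 - a ^ 2 := by
    rw [Real.sqrt_lt' one_pos]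
    constructor <;> intro <;> linarith
  have e2 : t * √(a ^ 2 + ‖y‖ ^ 2) ≤ a ↔ t ^ 2 * ‖y‖ ^ 2 ≤ a ^ 2 * (1 - t ^ 2) := by
    rw [← sq_le_sq₀ (by positivity) ha.le, mul_pow, Real.sq_sqrt hn]
    constructor <;> intro <;> linarith
  exact and_congr e1 e2

theorem area_ball (r : ℝ) (h : 0 ≤ r) : volume (ball (0 : En 2) √r) = ENNReal.ofReal (π * r) := by
  rw [InnerProductSpace.volume_ball_of_dim_even (k := 1) (by simp)]
  simp [← ENNReal.ofReal_pow (Real.sqrt_nonneg _), Real.sq_sqrt h]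
  rw [mul_comm, ENNReal.ofReal_mul pi_pos.le]

theorem area_closedBall (r : ℝ) (h : 0 ≤ r) :
    volume (closedBall (0 : En 2) √r) = ENNReal.ofReal (π * r) := by
  rw [Measure.addHaar_closedBall_eq_addHaar_ball, area_ball r h]

theorem slice_low (t : ℝ) (a : ℝ) (ha : 0 < a) (hat : a < t) (ht1 : t ≤ 1) :
    volume (Prod.mk a ⁻¹' coneT t) = ENNReal.ofReal (π * (a ^ 2 * (1 - t ^ 2) / t ^ 2)) := by
  have ht : 0 < t := ha.trans hat
  have h1 : 0 ≤ 1 - t ^ 2 := by nlinarith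
  rw [← area_closedBall _ (by positivity)]
  congr 1
  ext y
  rw [Set.mem_preimage, cone_cond t ht.le a ha, mem_closedBall_zero_iff,
    Real.le_sqrt (norm_nonneg _) (by positivity), le_div_iff₀ (by positivity)]
  constructor
  · rintro ⟨-, h⟩; linarith
  · intro h
    refine ⟨?_, by linarith⟩
    have h2 : a ^ 2 < t ^ 2 := by nlinarith
    have : ‖y‖ ^ 2 * t ^ 2 < (1 - a ^ 2) * t ^ 2 := by nlinarith
    exact lt_of_mul_lt_mul_right this (by positivity)

theorem slice_high (t : ℝ) (h0 : 0 ≤ t) (a : ℝ) (ha : 0 < a) (hat : t ≤ a) (ha1 : a < 1) :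
    volume (Prod.mk a ⁻¹' coneT t) = ENNReal.ofReal (π * (1 - a ^ 2)) := by
  have h1 : 0 ≤ 1 - a ^ 2 := by nlinarith
  rw [← area_ball _ h1]
  congr 1
  ext y
  rw [Set.mem_preimage, cone_cond t h0 a ha, mem_ball_zero_iff, Real.lt_sqrt (norm_nonneg _)]
  constructor
  · rintro ⟨h, -⟩; exact h
  · intro h
    refine ⟨h, ?_⟩
    have h2 : t ^ 2 ≤ a ^ 2 := by nlinarith
    nlinarith [mul_le_mul_of_nonneg_left h.le (sq_nonneg t)]

theorem slice_zero (t : ℝ) (h0 : 0 ≤ t) (a : ℝ) (ha : a < 0 ∨ 1 ≤ a) :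
    volume (Prod.mk a ⁻¹' coneT t) = 0 := by
  have : Prod.mk a ⁻¹' coneT t = ∅ := by
    ext y
    simp only [Set.mem_preimage, Set.mem_empty_iff_false, iff_false]
    rintro ⟨h1, h2⟩
    simp only at h1 h2
    have h3 := Real.sqrt_nonneg (a ^ 2 + ‖y‖ ^ 2)
    rcases ha with ha | ha
    · nlinarith
    · rw [Real.sqrt_lt' one_pos] at h1
      nlinarith [sq_nonneg ‖y‖]
  rw [this, measure_empty]

theorem vol_cone (t : ℝ) (h0 : 0 ≤ t) (h1 : t ≤ 1) :
    volume (coneT t) = ENNReal.ofReal (2 * π / 3 * (1 - t)) := by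
  have hA : ∀ᵐ a : ℝ, volume (Prod.mk a ⁻¹' coneT t) =
      (Set.Ioc 0 t).indicator (fun a => ENNReal.ofReal (π * (a ^ 2 * (1 - t ^ 2) / t ^ 2))) a +
      (Set.Ioc t 1).indicator (fun a => ENNReal.ofReal (π * (1 - a ^ 2))) a := by
    have n0 : ∀ᵐ a : ℝ, a ≠ 0 := Measure.ae_ne volume 0
    have n1 : ∀ᵐ a : ℝ, a ≠ t := Measure.ae_ne volume t
    have n2 : ∀ᵐ a : ℝ, a ≠ 1 := Measure.ae_ne volume 1
    filter_upwards [n0, n1, n2] with a ha0 hat ha1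
    rcases lt_or_gt_of_ne ha0 with h | h
    · rw [slice_zero t h0 a (Or.inl h), Set.indicator_of_notMem, Set.indicator_of_notMem, add_zero]
      · simp; intro; linarith
      · simp; intro; linarith
    rcases lt_or_gt_of_ne hat with h' | h'
    · rw [slice_low t a h h' h1, Set.indicator_of_mem, Set.indicator_of_notMem, add_zero]
      · simp; intro; linarith
      · exact ⟨h, h'.le⟩
    rcases lt_or_gt_of_ne ha1 with h'' | h''
    · rw [slice_high t h0 a h h'.le h'', Set.indicator_of_notMem, Set.indicator_of_mem, zero_add]
      · exact ⟨h', h''.le⟩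
      · simp; intro; linarith
    · rw [slice_zero t h0 a (Or.inr h''.le), Set.indicator_of_notMem, Set.indicator_of_notMem,
        add_zero]
      · simp; intro; linarith
      · simp; intro; linarith
  have e1 : 0 ≤ 1 - t ^ 2 := by nlinarith
  rw [Measure.volume_eq_prod, Measure.prod_apply (coneT_meas t), lintegral_congr_ae hA,
    lintegral_add_left (Measurable.indicator (by fun_prop) measurableSet_Ioc),
    lintegral_indicator measurableSet_Ioc, lintegral_indicator measurableSet_Ioc,
    ← ofReal_integral_eq_lintegral_ofReal, ← ofReal_integral_eq_lintegral_ofReal,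
    ← intervalIntegral.integral_of_le h0, ← intervalIntegral.integral_of_le h1,
    ← ENNReal.ofReal_add]
  · congr 1
    have i1 : ∫ a in (0:ℝ)..t, π * (a ^ 2 * (1 - t ^ 2) / t ^ 2) =
        π * ((1 - t ^ 2) / t ^ 2) * (t ^ 3 / 3) := by
      have : ∀ a : ℝ, π * (a ^ 2 * (1 - t ^ 2) / t ^ 2) = π * ((1 - t ^ 2) / t ^ 2) * a ^ 2 := by
        intro a; ring
      simp_rw [this]
      rw [intervalIntegral.integral_const_mul, integral_pow]
      norm_num
    have i2 : ∫ a in t..(1:ℝ), π * (1 - a ^ 2) = π * ((1 - t) - (1 - t ^ 3) / 3) := by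
      rw [intervalIntegral.integral_const_mul, intervalIntegral.integral_sub (by simp)
        (by apply Continuous.intervalIntegrable; fun_prop), integral_pow]
      norm_num
    rw [i1, i2]
    rcases h0.eq_or_lt with rfl | hpos
    · norm_num; ring
    · field_simp; ring
  · apply intervalIntegral.integral_nonneg h0
    intro a _
    positivity
  · apply intervalIntegral.integral_nonneg h1
    intro a ha
    have : 0 ≤ 1 - a ^ 2 := by nlinarith [ha.1, ha.2]
    positivity
  · apply Continuous.integrableOn_Ioc; fun_prop
  · filter_upwards [ae_restrict_mem measurableSet_Ioc] with a ha
    have : 0 ≤ 1 - a ^ 2 := by nlinarith [ha.1, ha.2]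
    simp only [Pi.zero_apply]
    positivity
  · have : Continuous fun a : ℝ => π * (a ^ 2 * (1 - t ^ 2) / t ^ 2) := by fun_prop
    exact this.integrableOn_Ioc
  · filter_upwards with a
    simp only [Pi.zero_apply]
    positivity

/-- uniform measure on the ball -/
def ballM : Measure (En 3) :=
  (volume (ball (0 : En 3) 1))⁻¹ • (volume : Measure (En 3)).restrict (ball 0 1)

/-- radial projection -/
def nrm (x : En 3) : En 3 := ‖x‖⁻¹ • x

theorem nrm_meas : Measurable nrm := by unfold nrm; fun_prop

instance ballM_prob : IsProbabilityMeasure ballM := by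
  constructor
  simp only [ballM, Measure.smul_apply, Measure.restrict_apply_univ, smul_eq_mul]
  exact ENNReal.inv_mul_cancel (isOpen_ball.measure_pos _ ⟨0, by simp⟩).ne' measure_ball_lt_top.ne

theorem ballM_map (f : En 3 ≃ₗᵢ[ℝ] En 3) : ballM.map f = ballM := by
  have h1 : ball (0 : En 3) 1 = f ⁻¹' (ball 0 1) := by ext x; simp
  have := (f.measurePreserving).restrict_preimage (isOpen_ball (x := (0 : En 3)) (ε := 1)).measurableSet
  rw [ballM, Measure.map_smul]
  congr 1
  conv_lhs => rw [h1]
  exact this.map_eq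

theorem ballM_ae : ∀ᵐ x ∂ballM, x ≠ 0 := by
  apply Measure.ae_smul_measure
  exact ae_restrict_of_ae (Measure.ae_ne volume 0)

theorem sigma_eq : sigmaN 3 = ballM.map nrm := by
  have : IsProbabilityMeasure (ballM.map nrm) :=
    Measure.isProbabilityMeasure_map nrm_meas.aemeasurable
  apply unique_single _ _ sigma_map _ sigma_ae
  · rw [ae_map_iff nrm_meas.aemeasurable
      (isClosed_eq (by fun_prop) (by fun_prop)).measurableSet]
    filter_upwards [ballM_ae] with x hx
    simp [nrm, norm_smul, hx]
  · intro f
    have hf : Measurable f := f.continuous.measurable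
    conv_rhs => rw [← ballM_map f]
    rw [Measure.map_map hf nrm_meas, Measure.map_map nrm_meas hf]
    congr 1
    ext x : 1
    simp [nrm]

theorem sigma_cap (t : ℝ) (h0 : 0 ≤ t) (h1 : t ≤ 1) :
    sigmaN 3 {x | t ≤ x 0} = ENNReal.ofReal ((1 - t) / 2) := by
  have hm : MeasurableSet {x : En 3 | t ≤ x 0} :=
    (isClosed_le (by fun_prop) (by fun_prop)).measurableSet
  rw [sigma_eq, Measure.map_apply nrm_meas hm, ballM, Measure.smul_apply,
    Measure.restrict_apply (nrm_meas hm), smul_eq_mul]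
  have e : volume (nrm ⁻¹' {x : En 3 | t ≤ x 0} ∩ ball 0 1) = volume (split3 ⁻¹' coneT t) := by
    apply measure_congr
    filter_upwards [Measure.ae_ne volume (0 : En 3)] with x hx
    apply propext
    have hx' : 0 < ‖x‖ := norm_pos_iff.2 hx
    change (t ≤ (‖x‖⁻¹ • x) 0 ∧ x ∈ ball 0 1) ↔ split3 x ∈ coneT t
    rw [coneT, Set.mem_ofPred_eq, ← split3_norm, mem_ball_zero_iff, and_comm]
    apply and_congr Iff.rfl
    simp only [PiLp.smul_apply, smul_eq_mul, split3]
    rw [inv_mul_eq_div, le_div_iff₀ hx']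
  rw [e, split3_mp.measure_preimage (coneT_meas t).nullMeasurableSet, vol_cone t h0 h1,
    EuclideanSpace.volume_ball_fin_three]
  simp only [ENNReal.ofReal_one, one_pow, one_mul]
  rw [← ENNReal.ofReal_inv_of_pos (by positivity), ← ENNReal.ofReal_mul (by positivity)]
  congr 1
  have := pi_pos
  field_simp
  ring

theorem sigma_law0 (s : ℝ) (h1 : -1 ≤ s) (h2 : s ≤ 1) :
    sigmaN 3 {x | x 0 < s} = ENNReal.ofReal ((1 + s) / 2) := by
  rcases lt_or_ge 0 s with h | h
  · have hm : MeasurableSet {x : En 3 | s ≤ x 0} :=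
      (isClosed_le (by fun_prop) (by fun_prop)).measurableSet
    have : {x : En 3 | x 0 < s} = {x : En 3 | s ≤ x 0}ᶜ := by ext x; simp
    rw [this, prob_compl_eq_one_sub hm, sigma_cap s h.le h2, ← ENNReal.ofReal_one,
      ← ENNReal.ofReal_sub _ (by linarith)]
    congr 1; ring
  · have hm : MeasurableSet {x : En 3 | x 0 < s} :=
      (isOpen_lt (by fun_prop) (by fun_prop)).measurableSet
    have hneg : sigmaN 3 {x | x 0 < s} = sigmaN 3 {x | -s < x 0} := by
      conv_lhs => rw [← sigma_map (LinearIsometryEquiv.neg ℝ)]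
      rw [Measure.map_apply (LinearIsometryEquiv.neg ℝ).continuous.measurable hm]
      congr 1
      ext x
      simp [neg_lt]
    rw [hneg]
    apply le_antisymm
    · calc sigmaN 3 {x | -s < x 0} ≤ sigmaN 3 {x | -s ≤ x 0} :=
            measure_mono fun x (hx : -s < x 0) => (le_of_lt hx : -s ≤ x 0)
        _ = _ := by
          rw [sigma_cap (-s) (by linarith) (by linarith)]
          congr 1; ring
    · have hlim : Tendsto (fun b : ℝ => ENNReal.ofReal ((1 - b) / 2)) (𝓝[>] (-s))
          (𝓝 (ENNReal.ofReal ((1 - (-s)) / 2))) := by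
        have : Continuous (fun b : ℝ => ENNReal.ofReal ((1 - b) / 2)) :=
          ENNReal.continuous_ofReal.comp (by fun_prop)
        exact (this.tendsto _).mono_left nhdsWithin_le_nhds
      rw [show (1 + s) / 2 = (1 - (-s)) / 2 by ring]
      apply le_of_tendsto hlim
      filter_upwards [self_mem_nhdsWithin] with b hb
      have hb : -s < b := hb
      rcases le_or_gt b 1 with hb1 | hb1
      · rw [← sigma_cap b (by linarith) hb1]
        exact measure_mono fun x hx => lt_of_lt_of_le hb hx
      · rw [ENNReal.ofReal_of_nonpos (by linarith)]
        exact zero_le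

theorem sigma_law (y : En 3) (hy : ‖y‖ = 1) (s : ℝ) (h1 : -1 ≤ s) (h2 : s ≤ 1) :
    sigmaN 3 {x | ⟪y, x⟫ < s} = ENNReal.ofReal ((1 + s) / 2) := by
  obtain ⟨f, -, hf⟩ := refl3_eq y hy
  have hm : MeasurableSet {x : En 3 | ⟪y, x⟫ < s} :=
    (isOpen_lt (by fun_prop) (by fun_prop)).measurableSet
  rw [← sigma_law0 s h1 h2]
  conv_lhs => rw [← sigma_map f]
  rw [Measure.map_apply f.continuous.measurable hm]
  congr 1
  ext x
  simp only [Set.mem_preimage, Set.mem_ofPred_eq]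
  rw [← hf, LinearIsometryEquiv.inner_map_map, inner_e0]

theorem QQ_law (s : ℝ) (h1 : -1 ≤ s) (h2 : s ≤ 1) :
    ((sigmaN 3).prod (sigmaN 3)).map (fun p => ⟪p.1, p.2⟫) (Set.Iio s) =
      ENNReal.ofReal ((1 + s) / 2) := by
  have hm : Measurable (fun p : En 3 × En 3 => ⟪p.1, p.2⟫) := by
    apply Continuous.measurable; fun_prop
  rw [Measure.map_apply hm measurableSet_Iio, Measure.prod_apply (hm measurableSet_Iio)]
  have : ∫⁻ y, sigmaN 3 (Prod.mk y ⁻¹' ((fun p : En 3 × En 3 => ⟪p.1, p.2⟫) ⁻¹' Set.Iio s))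
      ∂(sigmaN 3) = ∫⁻ y, ENNReal.ofReal ((1 + s) / 2) ∂(sigmaN 3) := by
    apply lintegral_congr_ae
    filter_upwards [sigma_ae] with y hy
    exact sigma_law y hy s h1 h2
  rw [this]; simp

theorem law_ext (P Q : Measure ℝ) [IsProbabilityMeasure P] [IsProbabilityMeasure Q]
    (hP : ∀ s, -1 ≤ s → s ≤ 1 → P (Set.Iio s) = ENNReal.ofReal ((1 + s) / 2))
    (hQ : ∀ s, -1 ≤ s → s ≤ 1 → Q (Set.Iio s) = ENNReal.ofReal ((1 + s) / 2)) : P = Q := by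
  have key : ∀ (M : Measure ℝ) [IsProbabilityMeasure M]
      (_ : ∀ s, -1 ≤ s → s ≤ 1 → M (Set.Iio s) = ENNReal.ofReal ((1 + s) / 2)) (s : ℝ),
      M (Set.Iio s) = ENNReal.ofReal ((1 + max (-1) (min s 1)) / 2) := by
    intro M _ hM s
    rcases le_or_gt s (-1) with h | h
    · rw [max_eq_left ((min_le_left _ _).trans h)]
      have := hM (-1) le_rfl (by norm_num)
      norm_num at this ⊢
      exact measure_mono_null (Set.Iio_subset_Iio h) this
    rcases le_or_gt s 1 with h' | h'
    · rw [min_eq_left h', max_eq_right h.le, hM s h.le h']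
    · rw [min_eq_right h'.le]
      have := hM 1 (by norm_num) le_rfl
      norm_num at this ⊢
      exact le_antisymm prob_le_one (this ▸ measure_mono (Set.Iio_subset_Iio h'.le))
  apply Measure.ext_of_Ici
  intro a
  rw [← Set.compl_Iio, prob_compl_eq_one_sub measurableSet_Iio,
    prob_compl_eq_one_sub measurableSet_Iio, key P hP, key Q hQ]

theorem final_eq : PP = (sigmaN 3).prod (sigmaN 3) := by
  have hm : Measurable (fun p : En 3 × En 3 => ⟪p.1, p.2⟫) := by
    apply Continuous.measurable; fun_prop
  apply unique_pair _ _ PP_map _ PP_ae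
  · have h1 := Measure.quasiMeasurePreserving_fst (μ := sigmaN 3) (ν := sigmaN 3) |>.ae sigma_ae
    have h2 := Measure.quasiMeasurePreserving_snd (μ := sigmaN 3) (ν := sigmaN 3) |>.ae sigma_ae
    filter_upwards [h1, h2] with p a b using ⟨a, b⟩
  · have i1 := Measure.isProbabilityMeasure_map (μ := PP) hm.aemeasurable
    have i2 := Measure.isProbabilityMeasure_map (μ := (sigmaN 3).prod (sigmaN 3)) hm.aemeasurable
    exact law_ext _ _ PP_law QQ_law
  · intro f
    have hf : Measurable f := f.continuous.measurable
    rw [← Measure.map_prod_map _ _ hf hf, sigma_map]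

/-- A random line (w.r.t. the normalized kinematic measure) intersects `S²` in two
probabilistically independent, uniformly distributed points: the pushforward of the
kinematic measure under the map sending a line to its ordered pair of intersection
points equals the product measure `σ ⊗ σ`. -/
theorem pushforward_kinematic_eq_prod :
    Measure.map (fun p : En 3 × En 3 => (Xpt 3 p, Ypt 3 p)) (kinematic 3) =
      (sigmaN 3).prod (sigmaN 3) := by
  exact final_eq

end
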